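/- The inductive limit G = lim_{→}{J_{l+1,l} : ℤ^{m(l)−1} → ℤ^{m(l+1)−1}}_{l ≥ 1} is isomorphic as an abelian group to the countable direct sum ⊕_{n∈ℕ} C(𝒦,ℤ) of copies of the group of continuous integer-valued functions on the Cantor space 𝒦. -/

import Mathlib

noncomputable section



open Finset

/-- Admissibility for the golden-mean (Fibonacci) shift: words over the alphabet
`{1,2}` (coded as `Fin 2`, where `0` codes the letter `1` and `1` codes the letter `2`)
with no two consecutive letters equal to `2`. -/
def DyckAdm (l : ℕ) (w : Fin l → Fin 2) : Prop :=
  ∀ i j : Fin l, (j : ℕ) = (i : ℕ) + 1 → ¬(w i = 1 ∧ w j = 1)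

instance (l : ℕ) : DecidablePred (DyckAdm l) := fun w => by
  unfold DyckAdm; infer_instance

/-- The set `W_l` of admissible words of length `l`. -/
def Wset (l : ℕ) : Finset (Fin l → Fin 2) := univ.filter (DyckAdm l)

/-- `m(l)`, the number of admissible words of length `l`. -/
def mW (l : ℕ) : ℕ := (Wset l).card

/-- Lexicographic (from the left) strict order on words. -/
def lexLt (l : ℕ) (u w : Fin l → Fin 2) : Prop :=
  ∃ i : Fin l, (∀ j : Fin l, j < i → u j = w j) ∧ u i < w i

instance (l : ℕ) : DecidableRel (lexLt l) := fun u w => by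
  unfold lexLt; infer_instance

/-- The (1-based) position of an admissible word in the lexicographic ordering of `W_l`,
identifying `W_l` with `{1, …, m(l)}`. -/
def rankW (l : ℕ) (w : Fin l → Fin 2) : ℕ :=
  1 + ((Wset l).filter (fun u => lexLt l u w)).card

/-- The matrix `I_{l,l+1}` (1-based indices, entries outside `{1,…,m(l)} × {1,…,m(l+1)}`
are `0`): `I_{l,l+1}(w,w') = 1` iff the word `w'` with its last letter deleted is `w`. -/
def Imat (l : ℕ) : ℕ → ℕ → ℤ := fun i j =>
  if ∃ w ∈ Wset l, ∃ w' ∈ Wset (l + 1),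
      rankW l w = i ∧ rankW (l + 1) w' = j ∧ (∀ k : Fin l, w k = w' k.castSucc)
  then 1 else 0

/-- The matrix `M_{l,l+1}` (1-based indices):
`M_{l,l+1}(w,w') = |{k ∈ {1,2} : w' = k·w}| + ε(w,w')`, where `ε(w,w') = 1` iff
`F(w_1,w'_1) = 1` and `(w_2,…,w_l) = (w'_1,…,w'_{l-1})`; `M_{0,1} = [3 2]`.
(Here `F(a,b) = 0` iff both letters are `2`, i.e. both codes are `1`.) -/
def Mmat : ℕ → ℕ → ℕ → ℤ
  | 0, i, j => if i = 1 ∧ j = 1 then 3 else if i = 1 ∧ j = 2 then 2 else 0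
  | (l + 1), i, j =>
      ∑ w ∈ Wset (l + 1), ∑ w' ∈ Wset (l + 2),
        if rankW (l + 1) w = i ∧ rankW (l + 2) w' = j then
          ((if (∀ t : Fin (l + 1), w' t.succ = w t) then (1 : ℤ) else 0) +
           (if (¬(w 0 = 1 ∧ w' 0 = 1)) ∧
               (∀ t : Fin (l + 1), (t : ℕ) ≠ 0 →
                 w t = w' ⟨(t : ℕ) - 1,
                   (Nat.sub_le _ _).trans_lt (t.isLt.trans (Nat.lt_succ_self _))⟩)
            then (1 : ℤ) else 0))
        else 0

/-- The matrices `S_l` (of size `m(l-1) × m(l+1)`, 1-based indices):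
`S_0 = [1 1]`, `S_1 = [1 1 1]`, `S_{l+2} = [[S_{l+1}, 0], [0, S_l]]` (block diagonal). -/
def Smat : ℕ → ℕ → ℕ → ℤ
  | 0, i, j => if i = 1 ∧ (1 ≤ j ∧ j ≤ 2) then 1 else 0
  | 1, i, j => if i = 1 ∧ (1 ≤ j ∧ j ≤ 3) then 1 else 0
  | (l + 2), i, j =>
      if i ≤ mW l then (if j ≤ mW (l + 2) then Smat (l + 1) i j else 0)
      else (if j ≤ mW (l + 2) then 0 else Smat l (i - mW l) (j - mW (l + 2)))

/-- The matrix `J_{l+1,l}` (1-based indices, size `(m(l+1)-1) × (m(l)-1)`):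
its first row is zero and `J_{l+1,l}(i,j) = I_{l,l+1}(j+1, i+1)` for `i ≥ 2`. -/
def Jnat (l : ℕ) : ℕ → ℕ → ℤ := fun i j =>
  if i ≤ 1 ∨ j = 0 then 0 else Imat l (j + 1) (i + 1)

/-- `J_{l+1,l}` as an additive map `ℤ^{m(l)-1} → ℤ^{m(l+1)-1}`. -/
def Jhom (l : ℕ) : (Fin (mW l - 1) → ℤ) →+ (Fin (mW (l + 1) - 1) → ℤ) :=
  (Matrix.mulVecLin
    (fun (i : Fin (mW (l + 1) - 1)) (j : Fin (mW l - 1)) =>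
      Jnat l ((i : ℕ) + 1) ((j : ℕ) + 1))).toAddMonoidHom

/-- The composition `J_{l+j,l+j-1} ∘ ⋯ ∘ J_{l+1,l} : ℤ^{m(l)-1} → ℤ^{m(l+j)-1}`. -/
def Jpush (l : ℕ) : ∀ j : ℕ, (Fin (mW l - 1) → ℤ) →+ (Fin (mW (l + j) - 1) → ℤ)
  | 0 => AddMonoidHom.id _
  | (j + 1) => (Jhom (l + j)).comp (Jpush l j)

/-- `id_ℤ ⊕ J_{n+1,n} : ℤ ⊕ ℤ^{m(n)-1} → ℤ ⊕ ℤ^{m(n+1)-1}`, written as a map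
`ℤ^{m(n)} → ℤ^{m(n+1)}` (the `ℤ` summand being the `0`-th coordinate). -/
def idJ (n : ℕ) : (Fin (mW n) → ℤ) →+ (Fin (mW (n + 1)) → ℤ) :=
  (Matrix.mulVecLin
    (fun (i : Fin (mW (n + 1))) (j : Fin (mW n)) =>
      if (i : ℕ) = 0 ∧ (j : ℕ) = 0 then 1 else Jnat n (i : ℕ) (j : ℕ))).toAddMonoidHom

/-- `g_k` computed at level `l`: `Σ_{j=1}^{k} |{i : 2 ≤ i ≤ m(l+1), I_{l,l+1}(j,i) = 1}|`. -/
def gAt (l k : ℕ) : ℕ :=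
  ∑ j ∈ Finset.Icc 1 k, ((Finset.Icc 2 (mW (l + 1))).filter (fun i => Imat l j i = 1)).card

/-- The sequence `g_k` (computed at level `l = k`, for which `m(l) ≥ k`). -/
def gk (k : ℕ) : ℕ := gAt k k

/-- The subgroup `ℤ(l;k) = {x ∈ ℤ^{m(l)-1} : x_i = 0 for all i ≤ g_k}` (1-based
coordinates; `ℤ(l;0) = ℤ^{m(l)-1}` since `g_0 = 0`). -/
def Zsub (l k : ℕ) : AddSubgroup (Fin (mW l - 1) → ℤ) where
  carrier := {x | ∀ i : Fin (mW l - 1), (i : ℕ) + 1 ≤ gk k → x i = 0}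
  add_mem' := by
    intro a b ha hb i hi
    simp [Pi.add_apply, ha i hi, hb i hi]
  zero_mem' := by intro i hi; rfl
  neg_mem' := by
    intro a ha i hi
    simp [Pi.neg_apply, ha i hi]

/-- The Cantor space `𝒦 = {0,1}^ℕ`. -/
abbrev Kspace : Type := ℕ → Bool

/-! ### Countable free abelian groups -/

/-- A submodule of the free module of countable rank over a principal ideal domain is free. -/
theorem Submodule.free_of_finsupp_nat {R : Type*} [CommRing R] [IsDomain R]
    [IsPrincipalIdealRing R] (N : Submodule R (ℕ →₀ R)) : Module.Free R N := by
  let I : ℕ → Ideal R := fun n =>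
    (N ⊓ Finsupp.supported R R (Set.Iic n)).map (Finsupp.lapply n)
  have hI : ∀ n, ∃ f ∈ N, (∀ m > n, f m = 0) ∧ f n = IsPrincipal.generator (I n) := by
    intro n
    obtain ⟨f, ⟨hfN, hf⟩, hfn⟩ := IsPrincipal.generator_mem (I n)
    exact ⟨f, hfN, fun m hm => (Finsupp.mem_supported' R f).1 hf m (not_le.2 hm), hfn⟩
  choose b hbN hb hbn using hI
  let S := {n : ℕ // b n n ≠ 0}
  let v : S → N := fun i => ⟨b i, hbN i⟩
  have hli : LinearIndependent R v := by
    refine LinearIndependent.of_comp N.subtype ?_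
    change LinearIndependent R fun i : S => b i
    rw [linearIndependent_iff]
    intro c hc
    by_contra hne
    let i := c.support.max' (Finsupp.support_nonempty_iff.2 hne)
    have hi : c i ≠ 0 := Finsupp.mem_support_iff.1 (c.support.max'_mem _)
    have hval := DFunLike.congr_fun hc (i : ℕ)
    rw [Finsupp.linearCombination_apply, Finsupp.sum, Finsupp.finsetSum_apply,
      Finset.sum_eq_single i] at hval
    · exact mul_ne_zero hi i.2 hval
    · intro j hj hji
      have : (j : ℕ) < i := lt_of_le_of_ne (c.support.le_max' j hj) fun h => hji (Subtype.ext h)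
      simp [hb j i this]
    · intro h
      exact absurd (c.support.max'_mem _) h
  have hspan : ∀ n : ℕ, ∀ f : N, (∀ m ≥ n, (f : ℕ →₀ R) m = 0) → f ∈ span R (Set.range v) := by
    intro n
    induction n with
    | zero =>
      intro f hf
      have : f = 0 := Subtype.ext (Finsupp.ext fun m => hf m m.zero_le)
      exact this ▸ zero_mem _
    | succ n ih =>
      intro f hf
      have hmem : (f : ℕ →₀ R) n ∈ I n :=
        ⟨f, ⟨f.2, (Finsupp.mem_supported' R _).2 fun m hm => hf m (Nat.lt_of_not_le hm)⟩, rfl⟩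
      obtain ⟨k, hk⟩ := (IsPrincipal.mem_iff_eq_smul_generator (I n)).1 hmem
      rw [← hbn n] at hk
      by_cases h0 : b n n = 0
      · refine ih f fun m hm => ?_
        rcases hm.eq_or_lt with rfl | hm
        · rw [hk, h0, smul_zero]
        · exact hf m hm
      · have hsub : f - k • v ⟨n, h0⟩ ∈ span R (Set.range v) := by
          refine ih _ fun m hm => ?_
          rcases hm.eq_or_lt with rfl | hm
          · simp [v, hk]
          · simp [v, hf m hm, hb n m hm]
        have := add_mem hsub (smul_mem _ k (subset_span ⟨⟨n, h0⟩, rfl⟩))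
        rwa [show f - k • v ⟨n, h0⟩ + k • v ⟨n, h0⟩ = f from
          Subtype.ext (sub_add_cancel (f : ℕ →₀ R) _)] at this
  refine Module.Free.of_basis (Module.Basis.mk hli fun f _ => ?_)
  refine hspan ((f : ℕ →₀ R).support.sup id + 1) f fun m hm => ?_
  by_contra h
  have : m ≤ (f : ℕ →₀ R).support.sup id :=
    Finset.le_sup (f := id) (Finsupp.mem_support_iff.2 h)
  omega

/-- A module embedding into a countable free module over a principal ideal domain is free. -/
theorem Module.Free.of_injective_of_countable {R M F : Type*} [CommRing R] [IsDomain R]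
    [IsPrincipalIdealRing R] [AddCommGroup M] [Module R M] [AddCommGroup F] [Module R F]
    [Module.Free R F] [Countable F] (f : M →ₗ[R] F) (hf : Function.Injective f) :
    Module.Free R M := by
  let b := Module.Free.chooseBasis R F
  have : Countable (Module.Free.ChooseBasisIndex R F) := b.injective.countable
  obtain ⟨e, he⟩ := exists_injective_nat (Module.Free.ChooseBasisIndex R F)
  let g : M →ₗ[R] (ℕ →₀ R) := Finsupp.lmapDomain R R e ∘ₗ b.repr.toLinearMap ∘ₗ f
  have hg : Function.Injective g :=
    (Finsupp.mapDomain_injective he).comp (b.repr.injective.comp hf)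
  have := Submodule.free_of_finsupp_nat (LinearMap.range g)
  exact Module.Free.of_equiv (LinearEquiv.ofInjective g hg).symm

/-! ### Integer-valued functions on profinite spaces -/

/-- On a profinite space, continuous integer-valued functions form a free abelian group. -/
theorem ContinuousMap.free_int (X : Type) [TopologicalSpace X] [CompactSpace X] [T2Space X]
    [TotallyDisconnectedSpace X] : Module.Free ℤ C(X, ℤ) := by
  let e : LocallyConstant X ℤ ≃+ C(X, ℤ) :=
    { toFun := fun f => f.toContinuousMap
      invFun := fun f => ⟨f, (IsLocallyConstant.iff_continuous _).2 f.continuous⟩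
      left_inv := fun _ => rfl
      right_inv := fun _ => rfl
      map_add' := fun _ _ => rfl }
  have : Module.Free ℤ (LocallyConstant X ℤ) := LocallyConstant.freeOfProfinite (Profinite.of X)
  exact Module.Free.of_equiv e.toIntLinearEquiv

/-- On a compact metrizable space, there are countably many continuous integer-valued functions. -/
theorem ContinuousMap.countable_int (X : Type) [TopologicalSpace X] [CompactSpace X] [T2Space X]
    [SecondCountableTopology X] : Countable C(X, ℤ) := by
  have : DiscreteTopology C(X, ℤ) := by
    refine DiscreteTopology.of_forall_le_dist (r := 1) one_pos fun f g hfg => ?_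
    by_contra! h
    refine hfg (ContinuousMap.ext fun x => ?_)
    have hx := (ContinuousMap.dist_apply_le_dist x).trans_lt h
    rw [Int.dist_eq] at hx
    have : |f x - g x| < 1 := by exact_mod_cast hx
    have := Int.abs_lt_one_iff.1 this
    omega
  exact TopologicalSpace.separableSpace_iff_countable.1 inferInstance

/-- The direct sum of countably many copies of `C(𝒦, ℤ)` has countably infinite rank. -/
theorem rank_directSum_cantor :
    Module.rank ℤ (DirectSum ℕ fun _ => C(ℕ → Bool, ℤ)) = Cardinal.aleph0 := by
  have := ContinuousMap.countable_int (ℕ → Bool)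
  have := ContinuousMap.free_int (ℕ → Bool)
  rw [rank_directSum, Cardinal.sum_const]
  simp only [Cardinal.mk_nat, Cardinal.lift_id]
  refine Cardinal.mul_eq_left le_rfl ((rank_le_card ℤ _).trans (Cardinal.mk_le_aleph0)) ?_
  exact (Module.rank_pos_of_free).ne'

/-- A countable abelian group containing free subgroups of arbitrarily large finite rank has
countably infinite rank. -/
theorem rank_eq_aleph0 {G : Type} [AddCommGroup G] [Countable G]
    (h : ∀ n : ℕ, ∃ m ≥ n, ∃ f : (Fin m → ℤ) →+ G, Function.Injective f) :
    Module.rank ℤ G = Cardinal.aleph0 := by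
  refine le_antisymm ((rank_le_card ℤ G).trans Cardinal.mk_le_aleph0) ?_
  refine Cardinal.aleph0_le.2 fun n => ?_
  obtain ⟨m, hm, f, hf⟩ := h n
  have := LinearMap.rank_le_of_injective f.toIntLinearMap hf
  rw [rank_fin_fun] at this
  exact le_trans (by exact_mod_cast hm) this

/-! ### The lexicographic rank -/

theorem lexLt_iff_toLex {l : ℕ} {u w : Fin l → Fin 2} : lexLt l u w ↔ toLex u < toLex w := Iff.rfl

theorem rankW_lt_rankW {l : ℕ} {u w : Fin l → Fin 2} (hu : u ∈ Wset l) (h : lexLt l u w) :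
    rankW l u < rankW l w := by
  refine Nat.add_lt_add_left (card_lt_card (Finset.ssubset_iff_of_subset ?_ |>.2 ⟨u, ?_, ?_⟩)) 1
  · intro v hv
    rw [mem_filter] at hv ⊢
    exact ⟨hv.1, lt_trans (lexLt_iff_toLex.1 hv.2) h⟩
  · exact mem_filter.2 ⟨hu, h⟩
  · exact fun hu' => lt_irrefl (toLex u) (mem_filter.1 hu').2

theorem rankW_injOn (l : ℕ) : Set.InjOn (rankW l) (Wset l) := by
  intro u hu w hw h
  rcases lt_trichotomy (toLex u) (toLex w) with hlt | heq | hlt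
  · exact absurd h (rankW_lt_rankW hu hlt).ne
  · exact toLex.injective heq
  · exact absurd h (rankW_lt_rankW hw hlt).ne'

theorem one_le_rankW (l : ℕ) (w : Fin l → Fin 2) : 1 ≤ rankW l w := Nat.le_add_right _ _

theorem rankW_le_mW {l : ℕ} {w : Fin l → Fin 2} (hw : w ∈ Wset l) : rankW l w ≤ mW l := by
  have : ((Wset l).filter fun u => lexLt l u w).card < mW l :=
    card_lt_card (filter_ssubset.2 ⟨w, hw, lt_irrefl (toLex w)⟩)
  unfold rankW
  omega

theorem exists_rankW_eq {l i : ℕ} (h1 : 1 ≤ i) (hi : i ≤ mW l) : ∃ w ∈ Wset l, rankW l w = i := by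
  have := Finset.surjOn_of_injOn_of_card_le (s := Wset l) (t := Icc 1 (mW l)) (rankW l)
    (fun w hw => by simpa using ⟨one_le_rankW l w, rankW_le_mW hw⟩) (rankW_injOn l)
    (by simp [mW])
  obtain ⟨w, hw, h⟩ := this (by simpa using ⟨h1, hi⟩)
  exact ⟨w, hw, h⟩

theorem zero_mem_Wset (l : ℕ) : (0 : Fin l → Fin 2) ∈ Wset l := by
  simp [Wset, DyckAdm]

theorem single_mem_Wset {l : ℕ} (i : Fin l) : (Pi.single i 1 : Fin l → Fin 2) ∈ Wset l := by
  refine mem_filter.2 ⟨mem_univ _, fun j k hjk h => ?_⟩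
  have hj : j = i := by by_contra hne; simp [hne] at h
  have hk : k = i := by by_contra hne; simp [hne] at h
  rw [hj, hk] at hjk
  omega

theorem le_mW (l : ℕ) : l + 1 ≤ mW l := by
  have hinj : Function.Injective
      (fun o : Option (Fin l) => o.elim 0 fun i => (Pi.single i 1 : Fin l → Fin 2)) := by
    rintro (_ | i) (_ | j) h
    · rfl
    · simpa using congrFun h j
    · simpa using congrFun h i
    · have := congrFun h i
      by_contra hne
      have hij : i ≠ j := fun h => hne (congrArg some h)
      simp [hij] at this
  have := Finset.card_le_card_of_injOn (s := univ) (t := Wset l) _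
    (fun o _ => ?_) hinj.injOn
  · simpa [mW] using this
  · cases o with
    | none => exact zero_mem_Wset l
    | some i => exact single_mem_Wset i

/-- If the prefix of a word is not the first word of its length, then the word is
neither the first nor the second word of its length. -/
theorem three_le_rankW {l : ℕ} {w : Fin (l + 1) → Fin 2}
    (h : 2 ≤ rankW l (fun k => w k.castSucc)) : 3 ≤ rankW (l + 1) w := by
  have hpos : 0 < ((Wset l).filter fun u => lexLt l u fun k => w k.castSucc).card := by
    unfold rankW at h; omega
  obtain ⟨u, hu⟩ := card_pos.1 hpos
  obtain ⟨i, -, hi⟩ := (mem_filter.1 hu).2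
  have hlt : toLex (0 : Fin l → Fin 2) < toLex (fun k : Fin l => w k.castSucc) := by
    refine lt_of_le_of_ne (Pi.toLex_monotone fun k => Fin.zero_le _) fun heq => ?_
    have := congrFun (toLex.injective heq) i
    simp only [Pi.zero_apply] at this
    exact Fin.not_lt_zero (u i) (hi.trans_eq this.symm)
  obtain ⟨k, hk, hkw⟩ := hlt
  have key : ∀ v : Fin (l + 1) → Fin 2, (∀ j : Fin l, v j.castSucc = 0) → lexLt (l + 1) v w := by
    refine fun v hv => ⟨k.castSucc, fun j hj => ?_, ?_⟩
    · obtain ⟨j, rfl⟩ := Fin.exists_castSucc_eq.2 (hj.trans_le (Fin.le_last _)).ne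
      rw [hv j]
      exact hk j (Fin.castSucc_lt_castSucc_iff.1 hj)
    · rw [hv k]
      exact hkw
  have h01 : lexLt (l + 1) 0 (Pi.single (Fin.last l) 1) :=
    ⟨Fin.last l, fun j hj => by simp [hj.ne], by simp⟩
  have h1 := rankW_lt_rankW (zero_mem_Wset _) h01
  have h2 := rankW_lt_rankW (single_mem_Wset _)
    (key (Pi.single (Fin.last l) 1) fun j => by simp [j.castSucc_lt_last.ne])
  have := one_le_rankW (l + 1) 0
  omega

/-! ### Vectors as functions on words -/

/-- The value at a word of the function on `W_l` given by a vector of `ℤ^{m(l)-1}`: the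
coordinate `j : Fin (mW l - 1)` belongs to the word of rank `j + 2`, and the first word is sent
to `0`. -/
def wordValue (l : ℕ) (x : Fin (mW l - 1) → ℤ) (w : Fin l → Fin 2) : ℤ :=
  ∑ j : Fin (mW l - 1), if rankW l w = j + 2 then x j else 0

theorem wordValue_add (l : ℕ) (x y : Fin (mW l - 1) → ℤ) (w : Fin l → Fin 2) :
    wordValue l (x + y) w = wordValue l x w + wordValue l y w := by
  rw [wordValue, wordValue, wordValue, ← sum_add_distrib]
  exact sum_congr rfl fun j _ => by split_ifs <;> simp

theorem wordValue_of_rankW_eq {l : ℕ} (x : Fin (mW l - 1) → ℤ) {w : Fin l → Fin 2}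
    (i : Fin (mW l - 1)) (h : rankW l w = i + 2) : wordValue l x w = x i := by
  rw [wordValue, sum_eq_single i]
  · simp [h]
  · intro j _ hj
    rw [if_neg]
    rw [h]
    exact fun h' => hj (Fin.ext (by omega))
  · simp

theorem wordValue_of_rankW_lt_two {l : ℕ} (x : Fin (mW l - 1) → ℤ) {w : Fin l → Fin 2}
    (h : rankW l w < 2) : wordValue l x w = 0 :=
  sum_eq_zero fun j _ => if_neg (by omega)

theorem init_mem_Wset {l : ℕ} {w : Fin (l + 1) → Fin 2} (hw : w ∈ Wset (l + 1)) :
    (fun k : Fin l => w k.castSucc) ∈ Wset l :=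
  mem_filter.2 ⟨mem_univ _, fun i j hij =>
    (mem_filter.1 hw).2 i.castSucc j.castSucc (by simpa using hij)⟩

theorem Imat_rankW {l : ℕ} {w : Fin (l + 1) → Fin 2} (hw : w ∈ Wset (l + 1)) (j : ℕ) :
    Imat l j (rankW (l + 1) w) = if rankW l (fun k => w k.castSucc) = j then 1 else 0 := by
  unfold Imat
  congr 1
  refine propext ⟨?_, fun h => ⟨_, init_mem_Wset hw, w, hw, h, rfl, fun _ => rfl⟩⟩
  rintro ⟨u, -, w', hw', hu, hr, huw⟩
  obtain rfl := rankW_injOn (l + 1) hw' hw hr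
  rw [← hu, funext huw]

/-- Under the identification of vectors with functions on words, `J_{l+1,l}` is the
composition with the prefix map. -/
theorem wordValue_Jhom (l : ℕ) (x : Fin (mW l - 1) → ℤ) {w : Fin (l + 1) → Fin 2}
    (hw : w ∈ Wset (l + 1)) :
    wordValue (l + 1) (Jhom l x) w = wordValue l x fun k => w k.castSucc := by
  by_cases h : rankW (l + 1) w < 2
  · rw [wordValue_of_rankW_lt_two _ h, wordValue_of_rankW_lt_two]
    by_contra h'
    have := three_le_rankW (not_lt.1 h')
    omega
  · have hle := rankW_le_mW hw
    have hi : rankW (l + 1) w = (rankW (l + 1) w - 2) + 2 := by omega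
    rw [wordValue_of_rankW_eq _ ⟨rankW (l + 1) w - 2, by omega⟩ hi]
    change ∑ j : Fin (mW l - 1), Jnat l (rankW (l + 1) w - 2 + 1) (j + 1) * x j = _
    refine sum_congr rfl fun j _ => ?_
    unfold Jnat
    rw [show rankW (l + 1) w - 2 + 1 + 1 = rankW (l + 1) w by omega, Imat_rankW hw]
    by_cases hj : rankW l (fun k => w k.castSucc) = j + 2
    · have := three_le_rankW (w := w) (by omega)
      rw [if_neg (by omega), if_pos hj, if_pos hj, one_mul]
    · rw [if_neg hj, if_neg hj, ite_self, zero_mul]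

/-! ### The golden mean shift -/

/-- The one-sided golden mean shift space. -/
abbrev GoldenMean : Type := {ω : ℕ → Fin 2 // ∀ i, ¬(ω i = 1 ∧ ω (i + 1) = 1)}

instance : CompactSpace GoldenMean := by
  refine isCompact_iff_compactSpace.1 (IsClosed.isCompact ?_)
  change IsClosed {ω : ℕ → Fin 2 | ∀ i, ¬(ω i = 1 ∧ ω (i + 1) = 1)}
  rw [Set.ofPred_forall]
  refine isClosed_iInter fun i => ?_
  have hcont : Continuous fun ω : ℕ → Fin 2 => (ω i, ω (i + 1)) := by fun_prop
  exact (isClosed_discrete {p : Fin 2 × Fin 2 | ¬(p.1 = 1 ∧ p.2 = 1)}).preimage hcont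

instance : SecondCountableTopology GoldenMean :=
  Topology.IsEmbedding.subtypeVal.secondCountableTopology

/-- The continuous function on the golden mean shift depending on the first `l` letters
that is given by a vector of `ℤ^{m(l)-1}`. -/
def cylinderHom (l : ℕ) : (Fin (mW l - 1) → ℤ) →+ C(GoldenMean, ℤ) :=
  AddMonoidHom.mk'
    (fun x => ⟨fun ω => wordValue l x fun k => ω.1 k,
      (continuous_of_discreteTopology (f := wordValue l x)).comp
        (continuous_pi fun k => (continuous_apply (k : ℕ)).comp continuous_subtype_val)⟩)
    fun x y => ContinuousMap.ext fun _ => wordValue_add l x y _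

theorem cylinderHom_apply (l : ℕ) (x : Fin (mW l - 1) → ℤ) (ω : GoldenMean) :
    cylinderHom l x ω = wordValue l x fun k => ω.1 k := rfl

theorem cylinderHom_Jhom (l : ℕ) (x : Fin (mW l - 1) → ℤ) :
    cylinderHom (l + 1) (Jhom l x) = cylinderHom l x :=
  ContinuousMap.ext fun ω => wordValue_Jhom l x <| mem_filter.2 ⟨mem_univ _, fun i j hij => by
    simpa [hij] using ω.2 i⟩

theorem cylinderHom_Jpush (l j : ℕ) (x : Fin (mW l - 1) → ℤ) :
    cylinderHom (l + j) (Jpush l j x) = cylinderHom l x := by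
  induction j with
  | zero => rfl
  | succ j ih => exact (cylinderHom_Jhom (l + j) _).trans ih

theorem cylinderHom_injective (l : ℕ) : Function.Injective (cylinderHom l) := by
  refine (injective_iff_map_eq_zero _).2 fun x hx => funext fun i => ?_
  obtain ⟨w, hw, hwi⟩ := exists_rankW_eq (l := l) (i := i + 2) (by omega) (by omega)
  let ω : GoldenMean := ⟨fun k => if h : k < l then w ⟨k, h⟩ else 0, fun k hk => by
    by_cases h : k + 1 < l
    · have h' : k < l := by omega
      simp only [h, h', dif_pos] at hk
      exact (mem_filter.1 hw).2 _ _ rfl hk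
    · simp [h] at hk⟩
  have hω : (fun k : Fin l => ω.1 k) = w := funext fun k => by simp [ω]
  have := DFunLike.congr_fun hx ω
  rwa [cylinderHom_apply, hω, wordValue_of_rankW_eq x i hwi] at this

/-! ### The inductive limit -/

section Limit

variable {G : Type} [AddCommGroup G] {ψ : ∀ n : ℕ, (Fin (mW (n + 1) - 1) → ℤ) →+ G}

theorem exists_lift_of_le
    (hψ : ∀ (n : ℕ) (x : Fin (mW (n + 1) - 1) → ℤ), ψ (n + 1) (Jhom (n + 1) x) = ψ n x)
    {n N : ℕ} (hN : n ≤ N) (x : Fin (mW (n + 1) - 1) → ℤ) :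
    ∃ y, ψ N y = ψ n x ∧ cylinderHom (N + 1) y = cylinderHom (n + 1) x := by
  induction N, hN using Nat.le_induction with
  | base => exact ⟨x, rfl, rfl⟩
  | succ N _ ih =>
    obtain ⟨y, hy, hy'⟩ := ih
    exact ⟨Jhom (N + 1) y, (hψ N y).trans hy, (cylinderHom_Jhom (N + 1) y).trans hy'⟩

theorem cylinderHom_eq_zero_of_limit_eq_zero
    (hker : ∀ (n : ℕ) (x : Fin (mW (n + 1) - 1) → ℤ),
      ψ n x = 0 → ∃ j : ℕ, Jpush (n + 1) j x = 0)
    {n : ℕ} {x : Fin (mW (n + 1) - 1) → ℤ} (h : ψ n x = 0) : cylinderHom (n + 1) x = 0 := by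
  obtain ⟨j, hj⟩ := hker n x h
  rw [← cylinderHom_Jpush (n + 1) j x, hj, map_zero]

/-- The inductive limit embeds into the continuous functions on the golden mean shift. -/
theorem exists_injective_limit
    (hψ : ∀ (n : ℕ) (x : Fin (mW (n + 1) - 1) → ℤ), ψ (n + 1) (Jhom (n + 1) x) = ψ n x)
    (hsurj : ∀ g : G, ∃ (n : ℕ) (x : Fin (mW (n + 1) - 1) → ℤ), ψ n x = g)
    (hker : ∀ (n : ℕ) (x : Fin (mW (n + 1) - 1) → ℤ),
      ψ n x = 0 → ∃ j : ℕ, Jpush (n + 1) j x = 0) :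
    ∃ Φ : G →+ C(GoldenMean, ℤ), Function.Injective Φ := by
  choose n x hx using hsurj
  have hwd : ∀ g (m : ℕ) (y : Fin (mW (m + 1) - 1) → ℤ), ψ m y = g →
      cylinderHom (m + 1) y = cylinderHom (n g + 1) (x g) := by
    intro g m y hy
    obtain ⟨y', h1, h2⟩ := exists_lift_of_le hψ (le_max_left m (n g)) y
    obtain ⟨x', h3, h4⟩ := exists_lift_of_le hψ (le_max_right m (n g)) (x g)
    rw [← h2, ← h4, ← sub_eq_zero, ← map_sub]
    refine cylinderHom_eq_zero_of_limit_eq_zero hker ?_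
    rw [map_sub, h1, h3, hy, hx, sub_self]
  refine ⟨AddMonoidHom.mk' (fun g => cylinderHom (n g + 1) (x g)) fun g h => ?_,
    (injective_iff_map_eq_zero _).2 fun g hg => ?_⟩
  · obtain ⟨y, h1, h2⟩ := exists_lift_of_le hψ (le_max_left (n g) (n h)) (x g)
    obtain ⟨z, h3, h4⟩ := exists_lift_of_le hψ (le_max_right (n g) (n h)) (x h)
    rw [← hwd (g + h) _ (y + z) (by rw [map_add, h1, h3, hx, hx]), map_add, h2, h4]
  · have : x g = 0 := cylinderHom_injective _ (hg.trans (map_zero _).symm)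
    rw [← hx g, this, map_zero]

end Limit

/-- the inductive limit
`G = lim_{→} {J_{l+1,l} : ℤ^{m(l)-1} → ℤ^{m(l+1)-1}}_{l ≥ 1}` is isomorphic to the
countable direct sum `⊕_{n ∈ ℕ} C(𝒦,ℤ)`: whenever a family `ψ` presents a group `G` as
that inductive limit (compatible, jointly surjective, with only eventually-vanishing
elements in the kernels), `G ≅ ⊕_{n ∈ ℕ} C(𝒦,ℤ)`. -/
theorem limitJ_iso_directSum :
    ∀ (G : Type) [AddCommGroup G]
      (ψ : ∀ n : ℕ, (Fin (mW (n + 1) - 1) → ℤ) →+ G),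
      (∀ (n : ℕ) (x : Fin (mW (n + 1) - 1) → ℤ), ψ (n + 1) (Jhom (n + 1) x) = ψ n x) →
      (∀ g : G, ∃ (n : ℕ) (x : Fin (mW (n + 1) - 1) → ℤ), ψ n x = g) →
      (∀ (n : ℕ) (x : Fin (mW (n + 1) - 1) → ℤ),
          ψ n x = 0 → ∃ j : ℕ, Jpush (n + 1) j x = 0) →
      Nonempty (G ≃+ DirectSum ℕ (fun _ => ContinuousMap Kspace ℤ)) := by
  intro G _ ψ hψ hsurj hker
  obtain ⟨Φ, hΦ⟩ := exists_injective_limit hψ hsurj hker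
  have := ContinuousMap.free_int GoldenMean
  have := ContinuousMap.countable_int GoldenMean
  have := ContinuousMap.free_int Kspace
  have : Countable G := hΦ.countable
  have : Module.Free ℤ G := Module.Free.of_injective_of_countable Φ.toIntLinearMap hΦ
  have hrank : Module.rank ℤ G = Cardinal.aleph0 := by
    refine rank_eq_aleph0 fun n => ⟨mW (n + 1) - 1, by have := le_mW (n + 1); omega, ψ n, ?_⟩
    refine (injective_iff_map_eq_zero _).2 fun x hx => cylinderHom_injective _ ?_
    rw [cylinderHom_eq_zero_of_limit_eq_zero hker hx, map_zero]
  obtain ⟨e⟩ := nonempty_linearEquiv_of_rank_eq (hrank.trans rank_directSum_cantor.symm)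
  exact ⟨e.toAddEquiv⟩
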